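/- Under the Random-Push algorithm, for the item v of rank i at time t, the expected number W_i of requests, occurring since v's last request and before time t, to items whose depth at the time of their request was larger than v's depth at that moment, satisfies E[W_i] ≤ 2i − 1. -/

import Mathlib

/-!
Model: `n` items (elements of `Fin n`) are stored, one per server, on the `n`
servers of a fixed complete binary tree.  Servers are indexed in heap order by
`Fin n` (server `s` has heap index `s + 1`); the root (index `0`) has depth `0`.
A configuration is a bijection `Fin n ≃ Fin n` from items to servers; the depth
of an item is the depth of its hosting server.
-/

/-- Depth of the server with 0-based heap index `s` in the complete binary tree
(the root, index `0`, has depth `0`). -/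
def sDepth {n : ℕ} (s : Fin n) : ℕ := Nat.log 2 (s.val + 1)

/-- The parent server of `s` in the complete binary tree (the root is its own parent). -/
def sParent {n : ℕ} (s : Fin n) : Fin n :=
  ⟨(s.val + 1) / 2 - 1, by
    have h := Nat.div_le_self (s.val + 1) 2
    have h2 := s.isLt
    omega⟩

/-- Apply a list of swaps to a configuration (a bijection from items to servers):
each swap exchanges the item at the given server with the item at its parent server,
at unit cost per swap. -/
def applySwaps {n : ℕ} (l : List (Fin n)) (c : Fin n ≃ Fin n) : Fin n ≃ Fin n :=
  l.foldl (fun c s => c.trans (Equiv.swap s (sParent s))) c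

/-- The rank of item `v` at time `t` (the number of distinct items requested since the
last request to `v` prior to `t`, including `v`): upon a request to an item its rank
becomes `1`, the ranks of items with smaller rank increase by one, and all other ranks
are unchanged.  Initially the ranks are induced by the bijection `r0`
(`itemRank r0 σ 0 v = r0 v + 1`, a permutation of `1, …, n`). -/
def itemRank {n : ℕ} (r0 : Fin n ≃ Fin n) (σ : ℕ → Fin n) : ℕ → Fin n → ℕ
  | 0 => fun v => (r0 v).val + 1
  | t + 1 => fun v =>
      if v = σ t then 1
      else if itemRank r0 σ t v < itemRank r0 σ t (σ t) then itemRank r0 σ t v + 1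
      else itemRank r0 σ t v

/-- The child of server `s` in the complete binary tree: `2s + 1` (left, `b = false`)
or `2s + 2` (right, `b = true`); returns `s` itself if the child index is out of range
(which never happens for servers above the last level of a complete tree). -/
def rpChild {n : ℕ} (s : Fin n) (b : Bool) : Fin n :=
  if h : 2 * s.val + (if b then 2 else 1) < n then
    ⟨2 * s.val + (if b then 2 else 1), h⟩
  else s

/-- The random root-to-bottom path determined by the coin flips `flips`:
it starts at the root and at each server steps to one of its two children
according to the next coin flip. -/
def rpPath {n : ℕ} (hpos : 0 < n) (flips : ℕ → Bool) : ℕ → Fin n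
  | 0 => ⟨0, hpos⟩
  | j + 1 => rpChild (rpPath hpos flips j) (flips j)

/-- One step of the Random-Push (Push-Down Tree) algorithm, serving a request to item
`u` hosted at server `s = c u` at depth `d`: `u` moves to the root, the items on the
random root-to-depth-`d` path determined by `flips` (starting with the former root
item) are shifted down one level along the path, and the item at the end of the path
moves to `s`.  The resulting relocation of items is the cyclic permutation of servers
`root → p 1 → ⋯ → p d → s → root`, given by `List.formPerm` of the path. -/
def rpStep {n : ℕ} (hpos : 0 < n) (flips : ℕ → Bool) (u : Fin n)
    (c : Fin n ≃ Fin n) : Fin n ≃ Fin n :=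
  c.trans (List.formPerm
    (((List.range (sDepth (c u) + 1)).map (rpPath hpos flips)) ++ [c u]))

/-- The (random) configuration of the Random-Push algorithm at each time, starting
from the initial configuration `c0`, serving the request sequence `σ`, with coin
flips `ω t` used when serving the request at time `t`. -/
def rpConf {n : ℕ} (hpos : 0 < n) (c0 : Fin n ≃ Fin n) (σ : ℕ → Fin n)
    (ω : ℕ → ℕ → Bool) : ℕ → Fin n ≃ Fin n
  | 0 => c0
  | t + 1 => rpStep hpos (ω t) (σ t) (rpConf hpos c0 σ ω t)

/-- Extend a finite table of fair coin flips (`m` time steps, at most `K` flips per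
step — enough for a complete tree of `2^K - 1` servers) to a total function. -/
def extendFlips (m K : ℕ) (ω : Fin m → Fin K → Bool) : ℕ → ℕ → Bool :=
  fun t j => if h : t < m ∧ j < K then ω ⟨t, h.1⟩ ⟨j, h.2⟩ else false

section

open scoped BigOperators
open Finset

/-- A finite row of coin flips, extended by `false` to an infinite one. -/
def extendRow (K : ℕ) (b : Fin K → Bool) : ℕ → Bool :=
  fun j => if h : j < K then b ⟨j, h⟩ else false

theorem extendFlips_eq_extendRow {t K : ℕ} (ω : Fin t → Fin K → Bool) {s : ℕ} (hs : s < t) :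
    extendFlips t K ω s = extendRow K (ω ⟨s, hs⟩) := by
  funext j
  by_cases hj : j < K <;> simp [extendFlips, extendRow, hs, hj]

/-- Averaging over one coordinate of a product separately does not change the mean. -/
theorem expect_apply_eq_expect_expect {ι α : Type*} [Fintype ι] [DecidableEq ι] [Fintype α]
    [Nonempty α] (i : ι) (h : (ι → α) → α → ℝ)
    (hinv : ∀ ω r r', h (Function.update ω i r) r' = h ω r') :
    𝔼 ω, h ω (ω i) = 𝔼 ω, 𝔼 r, h ω r := by
  let φ : (ι → α) × α → (ι → α) × α := fun q => (Function.update q.1 i q.2, q.1 i)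
  have hφ : Function.Involutive φ := by
    rintro ⟨ω, r⟩
    simp [φ]
  have key : 𝔼 q : (ι → α) × α, h q.1 q.2 = 𝔼 q : (ι → α) × α, h q.1 (q.1 i) := by
    refine Fintype.expect_equiv hφ.toPerm _ _ ?_
    rintro ⟨ω, r⟩
    simp [φ, hinv]
  have e1 := expect_product' (univ : Finset (ι → α)) (univ : Finset α) h
  have e2 := expect_product' (univ : Finset (ι → α)) (univ : Finset α) (fun ω _ => h ω (ω i))
  rw [univ_product_univ] at e1 e2
  rw [← e1, key, e2]
  simp

theorem sDepth_lt {K n : ℕ} (hn : n = 2 ^ K - 1) (a : Fin n) : sDepth a < K := by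
  have := a.isLt
  exact Nat.log_lt_of_lt_pow (by omega) (by omega)

theorem two_pow_sDepth_le {n : ℕ} (a : Fin n) : 2 ^ sDepth a ≤ a.val + 1 :=
  Nat.pow_log_le_self 2 (by omega)

theorem lt_two_pow_sDepth_succ {n : ℕ} (a : Fin n) : a.val + 1 < 2 ^ (sDepth a + 1) :=
  Nat.lt_pow_succ_log_self (by norm_num) _

theorem rpChild_val {K n : ℕ} (hn : n = 2 ^ K - 1) (a : Fin n) (ha : sDepth a + 1 < K)
    (b : Bool) : (rpChild a b).val = 2 * a.val + if b then 2 else 1 := by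
  have h1 := lt_two_pow_sDepth_succ a
  have h2 : 2 ^ (sDepth a + 2) ≤ 2 ^ K := Nat.pow_le_pow_right (by norm_num) (by omega)
  have h3 : 2 ^ (sDepth a + 2) = 2 * 2 ^ (sDepth a + 1) := by ring
  have h : 2 * a.val + (if b then 2 else 1) < n := by split <;> omega
  rw [rpChild, dif_pos h]

theorem sDepth_rpChild {K n : ℕ} (hn : n = 2 ^ K - 1) (a : Fin n) (ha : sDepth a + 1 < K)
    (b : Bool) : sDepth (rpChild a b) = sDepth a + 1 := by
  have h1 := lt_two_pow_sDepth_succ a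
  have h2 := two_pow_sDepth_le a
  rw [sDepth, rpChild_val hn a ha b, Nat.log_eq_iff (by omega)]
  rw [pow_succ, pow_succ] at *
  split <;> omega

theorem sDepth_rpPath {K n : ℕ} (hn : n = 2 ^ K - 1) (hpos : 0 < n) (flips : ℕ → Bool) {j : ℕ}
    (hj : j < K) : sDepth (rpPath hpos flips j) = j := by
  induction j with
  | zero => simp [rpPath, sDepth]
  | succ j ih =>
    have := ih (by omega)
    rw [rpPath, sDepth_rpChild hn _ (by omega), this]

theorem rpChild_eq_iff {K n : ℕ} (hn : n = 2 ^ K - 1) {a c : Fin n} (ha : sDepth a + 1 < K)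
    (hc : 0 < sDepth c) (b : Bool) :
    rpChild a b = c ↔ a = sParent c ∧ b = decide (c.val % 2 = 0) := by
  have hc' : c.val ≠ 0 := by
    intro h
    simp [sDepth, h] at hc
  rw [Fin.ext_iff, Fin.ext_iff, rpChild_val hn a ha b, sParent]
  cases b <;> simp <;> omega

theorem sDepth_sParent {n : ℕ} (c : Fin n) : sDepth (sParent c) = sDepth c - 1 := by
  have h : (c.val + 1) / 2 - 1 + 1 = (c.val + 1) / 2 ∨ c.val = 0 := by omega
  rcases h with h | h
  · rw [sDepth, sDepth, sParent, h, Nat.log_div_base]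
  · simp [sDepth, sParent, h]

theorem rpPath_congr {n : ℕ} (hpos : 0 < n) {f g : ℕ → Bool} {j : ℕ} (h : ∀ i < j, f i = g i) :
    rpPath hpos f j = rpPath hpos g j := by
  induction j with
  | zero => rfl
  | succ j ih => rw [rpPath, rpPath, ih fun i hi => h i (by omega), h j (by omega)]

/-- A server of depth `d` lies on the random path with probability `2⁻ᵈ`. -/
theorem expect_rpPath_eq {K n : ℕ} (hn : n = 2 ^ K - 1) (hpos : 0 < n) {d : ℕ} (a : Fin n)
    (ha : sDepth a = d) :
    𝔼 b : Fin K → Bool, (if rpPath hpos (extendRow K b) d = a then (1 : ℝ) else 0)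
      = ((2 : ℝ) ^ d)⁻¹ := by
  induction d generalizing a with
  | zero =>
    have h0 : a = ⟨0, hpos⟩ := by
      have := lt_two_pow_sDepth_succ a
      rw [ha] at this
      ext
      simp at this ⊢
      omega
    simp [rpPath, h0]
  | succ d ih =>
    have hK := sDepth_lt hn a
    have hd : d < K := by omega
    have key := expect_apply_eq_expect_expect (⟨d, hd⟩ : Fin K)
      (fun b r => if rpChild (rpPath hpos (extendRow K b) d) r = a then (1 : ℝ) else 0) (by
        intro b r r'
        have : rpPath hpos (extendRow K (Function.update b ⟨d, hd⟩ r)) d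
            = rpPath hpos (extendRow K b) d := by
          refine rpPath_congr hpos fun i hi => ?_
          have hiK : i < K := by omega
          simp [extendRow, hiK, hi.ne]
        simp only [this])
    have hrow : ∀ b : Fin K → Bool, extendRow K b d = b ⟨d, hd⟩ := fun b => by
      simp [extendRow, hd]
    simp only [rpPath, hrow]
    rw [key]
    have hin : ∀ b : Fin K → Bool,
        𝔼 r : Bool, (if rpChild (rpPath hpos (extendRow K b) d) r = a then (1 : ℝ) else 0)
          = (if rpPath hpos (extendRow K b) d = sParent a then (1 : ℝ) else 0) * 2⁻¹ := by
      intro b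
      have hs : sDepth (rpPath hpos (extendRow K b) d) + 1 < K := by
        rw [sDepth_rpPath hn hpos _ hd]
        omega
      simp only [rpChild_eq_iff hn hs (by omega : 0 < sDepth a)]
      rw [Fintype.expect_eq_sum_div_card]
      by_cases h : rpPath hpos (extendRow K b) d = sParent a <;>
        by_cases h2 : a.val % 2 = 0 <;> simp [h, h2]
    simp only [hin]
    rw [← expect_mul, ih _ (by rw [sDepth_sParent, ha]; rfl), pow_succ, mul_inv]

theorem getElem_map_range_concat {n e : ℕ} (p : ℕ → Fin n) (s : Fin n) {j : ℕ} (hj : j ≤ e)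
    (h : j < (((List.range (e + 1)).map p) ++ [s]).length) :
    (((List.range (e + 1)).map p) ++ [s])[j] = p j := by
  rw [List.getElem_append_left (by simp; omega)]
  simp

theorem nodup_map_range {n e : ℕ} {p : ℕ → Fin n} (hp : ∀ j < e, sDepth (p j) = j) :
    ((List.range e).map p).Nodup := by
  refine List.Nodup.map_on (fun x hx y hy hxy => ?_) List.nodup_range
  rw [List.mem_range] at hx hy
  rw [← hp x hx, ← hp y hy, hxy]

theorem formPerm_path_apply_last {n e : ℕ} (p : ℕ → Fin n) (s : Fin n) :
    List.formPerm (((List.range (e + 1)).map p) ++ [s]) s = p 0 := by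
  rw [List.range_succ_eq_map, List.map_cons, List.cons_append]
  exact List.formPerm_cons_concat_apply_last _ _ _

/-- When the path ends at the accessed server, listing that server twice is harmless. -/
theorem formPerm_path_of_eq {n e : ℕ} (p : ℕ → Fin n) :
    List.formPerm (((List.range (e + 1)).map p) ++ [p e])
      = List.formPerm ((List.range (e + 1)).map p) := by
  rw [List.range_succ, List.map_append, List.append_assoc]
  simp only [List.map_cons, List.map_nil, List.singleton_append]
  rw [List.formPerm_append_pair, Equiv.swap_self]
  exact mul_one _

theorem nodup_map_range_concat {n e : ℕ} {p : ℕ → Fin n} (hp : ∀ j ≤ e, sDepth (p j) = j)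
    {s : Fin n} (hs : sDepth s = e) (h : s ≠ p e) :
    (((List.range (e + 1)).map p) ++ [s]).Nodup := by
  rw [List.nodup_append]
  refine ⟨nodup_map_range fun j hj => hp j (by omega), by simp, ?_⟩
  intro a ha b hb hab
  simp only [List.mem_map, List.mem_range, List.mem_singleton] at ha hb
  obtain ⟨j, hj, rfl⟩ := ha
  have := hp j (by omega)
  rw [hab, hb, hs] at this
  subst this
  exact h (by rw [← hb, hab])

theorem formPerm_path_apply {n e : ℕ} {p : ℕ → Fin n} (hp : ∀ j ≤ e, sDepth (p j) = j)
    {s : Fin n} (hs : sDepth s = e) {j : ℕ} (hj : j < e) :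
    List.formPerm (((List.range (e + 1)).map p) ++ [s]) (p j) = p (j + 1) := by
  by_cases h : s = p e
  · subst h
    rw [formPerm_path_of_eq]
    have := List.formPerm_apply_lt_getElem _ (nodup_map_range (e := e + 1) (p := p)
      fun j hj => hp j (by omega)) j (by simp; omega)
    simpa using this
  · have := List.formPerm_apply_lt_getElem _ (nodup_map_range_concat hp hs h) j (by simp; omega)
    rwa [getElem_map_range_concat p s hj.le, getElem_map_range_concat p s hj] at this

theorem sDepth_formPerm_path {n e : ℕ} {p : ℕ → Fin n} (hp : ∀ j ≤ e, sDepth (p j) = j)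
    {s a : Fin n} (hs : sDepth s = e) (has : a ≠ s) :
    sDepth (List.formPerm (((List.range (e + 1)).map p) ++ [s]) a)
      = if sDepth a < e ∧ p (sDepth a) = a then sDepth a + 1 else sDepth a := by
  split
  case isTrue h =>
    conv_lhs => rw [← h.2]
    rw [formPerm_path_apply hp hs h.1, hp _ h.1]
  case isFalse h =>
    by_cases hmem : a ∈ ((List.range (e + 1)).map p) ++ [s]
    · simp only [List.mem_append, List.mem_map, List.mem_range, List.mem_singleton, has,
        or_false] at hmem
      obtain ⟨j, hj, rfl⟩ := hmem
      have hje : j = e := by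
        have := hp j (by omega)
        by_contra hne
        exact h ⟨by omega, by rw [this]⟩
      subst hje
      have := List.formPerm_apply_lt_getElem _ (nodup_map_range_concat hp hs has.symm) j
        (by simp)
      rw [getElem_map_range_concat p s le_rfl] at this
      rw [this, List.getElem_append_right (by simp)]
      simp [hs, hp j le_rfl]
    · rw [List.formPerm_apply_of_notMem hmem]

theorem sDepth_rpStep_self {n : ℕ} (hpos : 0 < n) (flips : ℕ → Bool) (u : Fin n)
    (c : Fin n ≃ Fin n) : sDepth (rpStep hpos flips u c u) = 0 := by
  rw [rpStep, Equiv.trans_apply, formPerm_path_apply_last]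
  simp [rpPath, sDepth]

theorem sDepth_rpStep_of_ne {K n : ℕ} (hn : n = 2 ^ K - 1) (hpos : 0 < n) (flips : ℕ → Bool)
    {u y : Fin n} (c : Fin n ≃ Fin n) (hy : y ≠ u) :
    sDepth (rpStep hpos flips u c y)
      = if sDepth (c y) < sDepth (c u) ∧ rpPath hpos flips (sDepth (c y)) = c y
        then sDepth (c y) + 1 else sDepth (c y) := by
  have hK := sDepth_lt hn (c u)
  rw [rpStep, Equiv.trans_apply]
  exact sDepth_formPerm_path (fun j hj => sDepth_rpPath hn hpos flips (by omega)) rfl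
    (fun h => hy (c.injective h))

/-- One step of Random-Push pushes an item `y` that lies above the accessed item down by one
level with probability `2⁻ᵈ`, where `d` is the depth of `y`. -/
theorem expect_rpStep {K n : ℕ} (hn : n = 2 ^ K - 1) (hpos : 0 < n) {u y : Fin n}
    (c : Fin n ≃ Fin n) (hy : y ≠ u) (g : ℕ → ℝ) :
    𝔼 b : Fin K → Bool, g (sDepth (rpStep hpos (extendRow K b) u c y))
      = g (sDepth (c y)) + if sDepth (c y) < sDepth (c u) then
          (g (sDepth (c y) + 1) - g (sDepth (c y))) * ((2 : ℝ) ^ sDepth (c y))⁻¹ else 0 := by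
  have h : ∀ b : Fin K → Bool, g (sDepth (rpStep hpos (extendRow K b) u c y))
      = g (sDepth (c y)) + (if sDepth (c y) < sDepth (c u) then
          g (sDepth (c y) + 1) - g (sDepth (c y)) else 0) *
          (if rpPath hpos (extendRow K b) (sDepth (c y)) = c y then (1 : ℝ) else 0) := by
    intro b
    rw [sDepth_rpStep_of_ne hn hpos _ c hy]
    split_ifs <;> simp_all
  simp only [h]
  rw [expect_add_distrib, ← mul_expect, expect_rpPath_eq hn hpos (c y) rfl]
  simp [ite_mul]

theorem expect_two_pow_rpStep {K n : ℕ} (hn : n = 2 ^ K - 1) (hpos : 0 < n) {u y : Fin n}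
    (c : Fin n ≃ Fin n) (hy : y ≠ u) :
    𝔼 b : Fin K → Bool, (2 : ℝ) ^ sDepth (rpStep hpos (extendRow K b) u c y)
      = 2 ^ sDepth (c y) + if sDepth (c y) < sDepth (c u) then 1 else 0 := by
  rw [expect_rpStep hn hpos c hy fun d => (2 : ℝ) ^ d]
  congr 2
  field_simp
  ring

theorem expect_two_pow_sq_rpStep {K n : ℕ} (hn : n = 2 ^ K - 1) (hpos : 0 < n) {u y : Fin n}
    (c : Fin n ≃ Fin n) (hy : y ≠ u) :
    𝔼 b : Fin K → Bool, ((2 : ℝ) ^ sDepth (rpStep hpos (extendRow K b) u c y)) ^ 2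
      = (2 ^ sDepth (c y)) ^ 2
        + if sDepth (c y) < sDepth (c u) then 3 * 2 ^ sDepth (c y) else 0 := by
  rw [expect_rpStep hn hpos c hy fun d => ((2 : ℝ) ^ d) ^ 2]
  congr 2
  field_simp
  ring

theorem card_filter_sDepth_lt {n : ℕ} (c : Fin n ≃ Fin n) (T : Finset (Fin n)) (e : ℕ) :
    #{y ∈ T | sDepth (c y) < e} + 1 ≤ 2 ^ e := by
  have h : #{y ∈ T | sDepth (c y) < e} ≤ #(range (2 ^ e - 1)) := by
    refine card_le_card_of_injOn (fun y => (c y).val) (fun y hy => ?_) (fun y _ z _ h => ?_)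
    · have h1 := lt_two_pow_sDepth_succ (c y)
      have h2 : 2 ^ (sDepth (c y) + 1) ≤ 2 ^ e :=
        Nat.pow_le_pow_right (by norm_num) (mem_filter.1 hy).2
      simp
      omega
    · exact c.injective (Fin.ext h)
  have := Nat.one_le_two_pow (n := e)
  rw [card_range] at h
  omega

theorem sq_le_three_mul_sum_two_pow_log (A : ℕ) :
    A ^ 2 ≤ 3 * ∑ h ∈ range A, 2 ^ Nat.log 2 (h + 1) := by
  have key : ∀ A : ℕ, 3 * ∑ h ∈ range (A + 1), 2 ^ Nat.log 2 (h + 1)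
      + 2 * (2 ^ Nat.log 2 (A + 1)) ^ 2 + 1
      = 3 * (A + 1) * 2 ^ Nat.log 2 (A + 1) + 3 * 2 ^ Nat.log 2 (A + 1) := by
    intro A
    induction A with
    | zero => simp
    | succ A ih =>
      rw [sum_range_succ]
      have h1 : 2 ^ Nat.log 2 (A + 1) ≤ A + 1 := Nat.pow_log_le_self 2 (by omega)
      have h2 : A + 1 < 2 ^ (Nat.log 2 (A + 1) + 1) := Nat.lt_pow_succ_log_self (by norm_num) _
      by_cases h : A + 1 + 1 < 2 ^ (Nat.log 2 (A + 1) + 1)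
      · have : Nat.log 2 (A + 1 + 1) = Nat.log 2 (A + 1) :=
          (Nat.log_eq_iff (by omega)).2 ⟨by omega, h⟩
        rw [this]
        linarith
      · have h3 : A + 1 + 1 = 2 ^ (Nat.log 2 (A + 1) + 1) := by omega
        have : Nat.log 2 (A + 1 + 1) = Nat.log 2 (A + 1) + 1 := by
          conv_lhs => rw [h3]
          exact Nat.log_pow (by norm_num) _
        rw [this]
        rw [pow_succ] at h3 ⊢
        generalize 2 ^ Nat.log 2 (A + 1) = q at *
        have h4 : A + 1 = 2 * q - 1 := by omega
        zify at *
        have h5 : (A : ℤ) = 2 * q - 2 := by linarith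
        rw [h5] at ih ⊢
        linarith
  rcases A with _ | A
  · simp
  · have h1 : 2 ^ Nat.log 2 (A + 1) ≤ A + 1 := Nat.pow_log_le_self 2 (by omega)
    have h2 : A + 1 < 2 ^ (Nat.log 2 (A + 1) + 1) := Nat.lt_pow_succ_log_self (by norm_num) _
    have h3 := key A
    have h4 := Nat.one_le_two_pow (n := Nat.log 2 (A + 1))
    rw [pow_succ] at h2
    generalize 2 ^ Nat.log 2 (A + 1) = q at *
    zify at *
    nlinarith [mul_nonneg (sub_nonneg.2 h1) (sub_nonneg.2 h2.le)]

theorem sum_range_card_le_sum {f : ℕ → ℕ} (hf : Monotone f) (H : Finset ℕ) :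
    ∑ h ∈ range #H, f h ≤ ∑ h ∈ H, f h := by
  induction H using Finset.induction_on_max with
  | empty => simp
  | insert a s ha ih =>
    have has : a ∉ s := fun h => lt_irrefl _ (ha a h)
    rw [card_insert_of_notMem has, sum_range_succ, sum_insert has, add_comm]
    refine add_le_add (hf ?_) ih
    simpa using card_le_card (fun x hx => mem_range.2 (ha x hx) : s ⊆ range a)

/-- Any `A` items have total weight at least `A² / 3`, as they occupy distinct servers. -/
theorem card_sq_le_sum_two_pow {n : ℕ} (c : Fin n ≃ Fin n) (T : Finset (Fin n)) :
    (#T : ℝ) ^ 2 ≤ 3 * ∑ y ∈ T, (2 : ℝ) ^ sDepth (c y) := by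
  have hinj : Set.InjOn (fun y => (c y).val) (T : Set (Fin n)) :=
    fun y _ z _ h => c.injective (Fin.ext h)
  have h1 := sq_le_three_mul_sum_two_pow_log #T
  have h2 := sum_range_card_le_sum (f := fun h => 2 ^ Nat.log 2 (h + 1))
    (fun a b hab => Nat.pow_le_pow_right (by norm_num) (Nat.log_mono_right (by omega)))
    (T.image fun y => (c y).val)
  rw [card_image_of_injOn hinj, sum_image hinj] at h2
  exact_mod_cast h1.trans (Nat.mul_le_mul_left 3 h2)

/-- The potential of a configuration relative to an item `v` and a set `T` of other items. -/
noncomputable def pushPotential {n : ℕ} (v : Fin n) (T : Finset (Fin n)) (c : Fin n ≃ Fin n) : ℝ :=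
  2 / 3 * (2 ^ sDepth (c v)) ^ 2 + ∑ y ∈ T, (2 : ℝ) ^ sDepth (c y) - #T * 2 ^ sDepth (c v)

theorem expect_pushPotential_insert {K n : ℕ} (hn : n = 2 ^ K - 1) (hpos : 0 < n) {u v : Fin n}
    (c : Fin n ≃ Fin n) (huv : v ≠ u) {T : Finset (Fin n)} (hu : u ∉ T) :
    𝔼 b : Fin K → Bool, pushPotential v (insert u T) (rpStep hpos (extendRow K b) u c)
      = 2 / 3 * ((2 ^ sDepth (c v)) ^ 2
          + if sDepth (c v) < sDepth (c u) then 3 * 2 ^ sDepth (c v) else 0)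
        + (1 + (∑ y ∈ T, (2 : ℝ) ^ sDepth (c y) + #{y ∈ T | sDepth (c y) < sDepth (c u)}))
        - (#T + 1) * (2 ^ sDepth (c v) + if sDepth (c v) < sDepth (c u) then 1 else 0) := by
  simp only [pushPotential]
  rw [expect_sub_distrib, expect_add_distrib, ← mul_expect, ← mul_expect,
    expect_two_pow_rpStep hn hpos c huv, expect_two_pow_sq_rpStep hn hpos c huv,
    expect_sum_comm, sum_insert hu, card_insert_of_notMem hu]
  have h : ∀ y ∈ T, 𝔼 b : Fin K → Bool, (2 : ℝ) ^ sDepth (rpStep hpos (extendRow K b) u c y)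
      = 2 ^ sDepth (c y) + if sDepth (c y) < sDepth (c u) then 1 else 0 := fun y hy =>
    expect_two_pow_rpStep hn hpos c (by rintro rfl; exact hu hy)
  rw [sum_congr rfl h, sum_add_distrib, sum_boole]
  simp [sDepth_rpStep_self]

theorem two_mul_two_pow_le {a b : ℕ} (h : a < b) : 2 * (2 : ℝ) ^ a ≤ 2 ^ b := by
  rw [← pow_succ']
  exact pow_le_pow_right₀ (by norm_num) h

/-- Requesting an item not in `T` and adding it to `T` increases the potential by at most the
weight of `v`. -/
theorem expect_pushPotential_insert_le {K n : ℕ} (hn : n = 2 ^ K - 1) (hpos : 0 < n)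
    {u v : Fin n} (c : Fin n ≃ Fin n) (huv : v ≠ u) {T : Finset (Fin n)} (hu : u ∉ T) :
    𝔼 b : Fin K → Bool, pushPotential v (insert u T) (rpStep hpos (extendRow K b) u c)
      ≤ pushPotential v T c + 2 ^ sDepth (c v) := by
  rw [expect_pushPotential_insert hn hpos c huv hu, pushPotential]
  have h1 : (#{y ∈ T | sDepth (c y) < sDepth (c u)} : ℝ) + 1 ≤ 2 ^ sDepth (c u) := by
    exact_mod_cast card_filter_sDepth_lt c T (sDepth (c u))
  have h2 : (#{y ∈ T | sDepth (c y) < sDepth (c u)} : ℝ) ≤ #T := by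
    exact_mod_cast card_filter_le _ _
  split_ifs with h
  · linarith
  · have : (2 : ℝ) ^ sDepth (c u) ≤ 2 ^ sDepth (c v) :=
      pow_le_pow_right₀ (by norm_num) (not_lt.1 h)
    linarith

/-- Requesting an item of `T` does not increase the expected potential. -/
theorem expect_pushPotential_of_mem_le {K n : ℕ} (hn : n = 2 ^ K - 1) (hpos : 0 < n)
    {u v : Fin n} (c : Fin n ≃ Fin n) (huv : v ≠ u) {T : Finset (Fin n)} (hu : u ∈ T) :
    𝔼 b : Fin K → Bool, pushPotential v T (rpStep hpos (extendRow K b) u c)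
      ≤ pushPotential v T c := by
  obtain ⟨T, hu', rfl⟩ : ∃ T', u ∉ T' ∧ T = insert u T' :=
    ⟨T.erase u, by simp, (insert_erase hu).symm⟩
  rw [expect_pushPotential_insert hn hpos c huv hu', pushPotential, sum_insert hu',
    card_insert_of_notMem hu']
  push_cast
  have h1 : (#{y ∈ T | sDepth (c y) < sDepth (c u)} : ℝ) + 1 ≤ 2 ^ sDepth (c u) := by
    exact_mod_cast card_filter_sDepth_lt c T (sDepth (c u))
  have h2 : (#{y ∈ T | sDepth (c y) < sDepth (c u)} : ℝ) ≤ #T := by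
    exact_mod_cast card_filter_le _ _
  split_ifs with h
  · have := two_mul_two_pow_le h
    linarith
  · linarith

theorem Ioo_self_succ (a : ℕ) : Ioo a (a + 1) = ∅ := by
  ext i
  simp

theorem Ioo_succ_right_eq_insert {a b : ℕ} (h : a + 1 ≤ b) :
    Ioo a (b + 1) = insert b (Ioo a b) := by
  ext i
  simp
  omega

theorem rpConf_congr {n : ℕ} (hpos : 0 < n) (c0 : Fin n ≃ Fin n) (σ : ℕ → Fin n)
    {ω ω' : ℕ → ℕ → Bool} {s : ℕ} (h : ∀ i < s, ω i = ω' i) :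
    rpConf hpos c0 σ ω s = rpConf hpos c0 σ ω' s := by
  induction s with
  | zero => rfl
  | succ s ih => rw [rpConf, rpConf, ih fun i hi => h i (by omega), h s (by omega)]

theorem expect_rpConf_succ {n t K : ℕ} (hpos : 0 < n) (c0 : Fin n ≃ Fin n) (σ : ℕ → Fin n) {s : ℕ}
    (hs : s < t) (F : (Fin n ≃ Fin n) → ℝ) :
    𝔼 ω : Fin t → Fin K → Bool, F (rpConf hpos c0 σ (extendFlips t K ω) (s + 1))
      = 𝔼 ω : Fin t → Fin K → Bool, 𝔼 b : Fin K → Bool,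
          F (rpStep hpos (extendRow K b) (σ s) (rpConf hpos c0 σ (extendFlips t K ω) s)) := by
  rw [← expect_apply_eq_expect_expect (⟨s, hs⟩ : Fin t) (fun ω b =>
    F (rpStep hpos (extendRow K b) (σ s) (rpConf hpos c0 σ (extendFlips t K ω) s)))]
  · simp only [rpConf, extendFlips_eq_extendRow _ hs]
  · intro ω r r'
    have : rpConf hpos c0 σ (extendFlips t K (Function.update ω ⟨s, hs⟩ r)) s
        = rpConf hpos c0 σ (extendFlips t K ω) s := by
      refine rpConf_congr hpos c0 σ fun i hi => ?_
      have hit : i < t := by omega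
      rw [extendFlips_eq_extendRow _ hit, extendFlips_eq_extendRow _ hit,
        Function.update_of_ne (by simp [hi.ne])]
    simp only [this]

theorem one_le_itemRank {n : ℕ} (r0 : Fin n ≃ Fin n) (σ : ℕ → Fin n) (s : ℕ) (w : Fin n) :
    1 ≤ itemRank r0 σ s w := by
  induction s with
  | zero => simp [itemRank]
  | succ s ih =>
    simp only [itemRank]
    split_ifs <;> omega

theorem itemRank_injective {n : ℕ} (r0 : Fin n ≃ Fin n) (σ : ℕ → Fin n) (s : ℕ) :
    Function.Injective (itemRank r0 σ s) := by
  induction s with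
  | zero =>
    intro a b h
    simp only [itemRank, add_left_inj] at h
    exact r0.injective (Fin.ext h)
  | succ s ih =>
    intro a b h
    have ha := one_le_itemRank r0 σ s a
    have hb := one_le_itemRank r0 σ s b
    by_contra hab
    have h1 : itemRank r0 σ s a ≠ itemRank r0 σ s b := fun h => hab (ih h)
    have h2 : a ≠ σ s → itemRank r0 σ s a ≠ itemRank r0 σ s (σ s) := fun h h' => h (ih h')
    have h3 : b ≠ σ s → itemRank r0 σ s b ≠ itemRank r0 σ s (σ s) := fun h h' => h (ih h')
    simp only [itemRank] at h
    split_ifs at h <;> first | omega | (simp_all; omega)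

/-- After a request to `v`, the items of rank at most that of `v` are `v` and the items requested
since. -/
theorem itemRank_eq_card_add_one {n : ℕ} (r0 : Fin n ≃ Fin n) (σ : ℕ → Fin n) {v : Fin n}
    {t0 s : ℕ} (hreq : σ t0 = v) (hs : t0 + 1 ≤ s) (hlast : ∀ i, t0 < i → i < s → σ i ≠ v) :
    (∀ w, w ∈ (Ioo t0 s).image σ ∨ w = v ↔ itemRank r0 σ s w ≤ itemRank r0 σ s v) ∧
      itemRank r0 σ s v = #((Ioo t0 s).image σ) + 1 := by
  induction s, hs using Nat.le_induction with
  | base =>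
    refine ⟨fun w => ?_, by simp [itemRank, hreq, Ioo_self_succ]⟩
    have h1 := one_le_itemRank r0 σ t0 w
    have h2 : w ≠ v → itemRank r0 σ t0 w ≠ itemRank r0 σ t0 v :=
      fun h h' => h (itemRank_injective r0 σ t0 h')
    have h3 := one_le_itemRank r0 σ t0 v
    simp only [itemRank, hreq, if_true, Ioo_self_succ]
    by_cases h : w = v
    · simp [h]
    · have := h2 h
      simp only [h, if_false]
      split_ifs <;> simp <;> omega
  | succ s hs ih =>
    obtain ⟨ih1, ih2⟩ := ih fun i hi his => hlast i hi (by omega)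
    have hv : v ≠ σ s := (hlast s (by omega) (by omega)).symm
    have inj := fun a b => @itemRank_injective n r0 σ s a b
    rw [Ioo_succ_right_eq_insert hs, image_insert]
    have hvm : v ∉ (Ioo t0 s).image σ := by
      simp only [mem_image, mem_Ioo, not_exists, not_and]
      exact fun i hi => hlast i hi.1 (by omega)
    have hσ := ih1 (σ s)
    have hne : itemRank r0 σ s v ≠ itemRank r0 σ s (σ s) := fun h => hv (inj _ _ h)
    constructor
    · intro w
      have hw := ih1 w
      have hwne : w ≠ σ s → itemRank r0 σ s w ≠ itemRank r0 σ s (σ s) :=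
        fun h h' => h (inj _ _ h')
      simp only [itemRank, hv, if_false, mem_insert, or_assoc]
      by_cases h : w = σ s
      · simp only [h, true_or, if_true, true_iff]
        split_ifs <;> omega
      · have := hwne h
        simp only [h, false_or, if_false, hw]
        split_ifs <;> omega
    · simp only [itemRank, hv, if_false]
      by_cases h : σ s ∈ (Ioo t0 s).image σ
      · rw [insert_eq_of_mem h, if_neg (by have := hσ.1 (Or.inl h); omega), ih2]
      · have : ¬ itemRank r0 σ s (σ s) ≤ itemRank r0 σ s v := fun h' =>
          (hσ.2 h').elim h fun h'' => hv h''.symm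
        rw [card_insert_of_notMem h, if_pos (by omega), ih2]

/-- A bound on the expected potential forces a bound on the expected weight of `v`. -/
theorem expect_two_pow_le_of_expect_pushPotential_le {Ω : Type*} [Fintype Ω] [Nonempty Ω] {n : ℕ}
    (v : Fin n) (T : Finset (Fin n)) (C : Ω → Fin n ≃ Fin n)
    (h : 𝔼 ω, pushPotential v T (C ω) ≤ 2 / 3 + (#T + 1) * #T) :
    𝔼 ω, (2 : ℝ) ^ sDepth (C ω v) ≤ 2 * (#T + 1) := by
  set A : ℝ := (#T : ℝ)
  have hA : 0 ≤ A := Nat.cast_nonneg _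
  have hpt : ∀ ω, (5 / 3 * A + 8 / 3) * (2 : ℝ) ^ sDepth (C ω v)
      + (A ^ 2 / 3 - 8 / 3 * (A + 1) ^ 2) ≤ pushPotential v T (C ω) := by
    intro ω
    rw [pushPotential]
    nlinarith [card_sq_le_sum_two_pow (C ω) T,
      sq_nonneg ((2 : ℝ) ^ sDepth (C ω v) - 2 * (A + 1))]
  have h2 := expect_le_expect (s := univ) fun ω _ => hpt ω
  rw [expect_add_distrib, ← mul_expect, Fintype.expect_const] at h2
  have h3 := h2.trans h
  by_contra! hc
  have h4 := mul_lt_mul_of_pos_left hc (by positivity : 0 < 5 / 3 * A + 8 / 3)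
  nlinarith

theorem expect_pushPotential_rpConf_le {K n : ℕ} (hn : n = 2 ^ K - 1) (hpos : 0 < n)
    (σ : ℕ → Fin n) (c0 : Fin n ≃ Fin n) {t t0 s : ℕ} {v : Fin n} (hreq : σ t0 = v)
    (hlast : ∀ i, t0 < i → i < t → σ i ≠ v) (hs : t0 + 1 ≤ s) (hst : s ≤ t) :
    𝔼 ω : Fin t → Fin K → Bool, pushPotential v ((Ioo t0 s).image σ)
        (rpConf hpos c0 σ (extendFlips t K ω) s)
      ≤ 2 / 3 + (#((Ioo t0 s).image σ) + 1) * #((Ioo t0 s).image σ) := by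
  induction s, hs using Nat.le_induction with
  | base =>
    have h : ∀ ω : Fin t → Fin K → Bool, pushPotential v ((Ioo t0 (t0 + 1)).image σ)
        (rpConf hpos c0 σ (extendFlips t K ω) (t0 + 1)) = 2 / 3 := by
      intro ω
      have := sDepth_rpStep_self hpos (extendFlips t K ω t0) v
        (rpConf hpos c0 σ (extendFlips t K ω) t0)
      simp [pushPotential, rpConf, hreq, this, Ioo_self_succ]
    simp only [h]
    simp [Ioo_self_succ]
  | succ s hs ih =>
    have hle := ih (by omega)
    have hv : v ≠ σ s := (hlast s (by omega) (by omega)).symm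
    rw [expect_rpConf_succ hpos c0 σ (by omega) (fun c => pushPotential v _ c), Ioo_succ_right_eq_insert hs, image_insert]
    by_cases h : σ s ∈ (Ioo t0 s).image σ
    · rw [insert_eq_of_mem h]
      exact (expect_le_expect fun ω _ => expect_pushPotential_of_mem_le hn hpos _ hv h).trans hle
    · have h1 := expect_two_pow_le_of_expect_pushPotential_le v _ _ hle
      refine (expect_le_expect fun ω _ => expect_pushPotential_insert_le hn hpos _ hv h).trans ?_
      rw [expect_add_distrib, card_insert_of_notMem h]
      push_cast
      linarith

/-- The weight of `v` grows, on average, by one with each request to a deeper item. -/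
theorem expect_card_deeper_requests {K n : ℕ} (hn : n = 2 ^ K - 1) (hpos : 0 < n)
    (σ : ℕ → Fin n) (c0 : Fin n ≃ Fin n) {t t0 s : ℕ} {v : Fin n} (hreq : σ t0 = v)
    (hlast : ∀ i, t0 < i → i < t → σ i ≠ v) (hs : t0 + 1 ≤ s) (hst : s ≤ t) :
    𝔼 ω : Fin t → Fin K → Bool, (#{r ∈ Ioo t0 s |
          sDepth (rpConf hpos c0 σ (extendFlips t K ω) r v) <
          sDepth (rpConf hpos c0 σ (extendFlips t K ω) r (σ r))} : ℝ)
      = 𝔼 ω : Fin t → Fin K → Bool,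
          (2 : ℝ) ^ sDepth (rpConf hpos c0 σ (extendFlips t K ω) s v) - 1 := by
  induction s, hs using Nat.le_induction with
  | base =>
    have h : ∀ ω : Fin t → Fin K → Bool,
        sDepth (rpConf hpos c0 σ (extendFlips t K ω) (t0 + 1) v) = 0 := by
      intro ω
      rw [rpConf, hreq]
      exact sDepth_rpStep_self _ _ _ _
    simp [h, Ioo_self_succ]
  | succ s hs ih =>
    have hv : v ≠ σ s := (hlast s (by omega) (by omega)).symm
    rw [expect_rpConf_succ hpos c0 σ (by omega) (fun c => (2 : ℝ) ^ sDepth (c v))]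
    simp only [expect_two_pow_rpStep hn hpos _ hv]
    rw [expect_add_distrib, add_sub_right_comm, ← ih (by omega), ← expect_add_distrib]
    refine expect_congr rfl fun ω _ => ?_
    rw [Ioo_succ_right_eq_insert hs, filter_insert]
    split_ifs
    · rw [card_insert_of_notMem (by simp)]
      push_cast
      rfl
    · simp

end

/-- Under the Random-Push algorithm, for the item `v` of rank `i` at time `t` (whose last
request before `t` was at time `t0`), the expected number `W_i` of requests occurring
since `v`'s last request and before time `t` to items whose depth at the time of their
request was larger than `v`'s depth at that moment satisfies `E[W_i] ≤ 2 i − 1`. -/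
theorem randompush_expected_deeper_requests_le
    (K : ℕ) (hK : 1 ≤ K) (n : ℕ) (hn : n = 2 ^ K - 1) (hpos : 0 < n)
    (r0 : Fin n ≃ Fin n) (σ : ℕ → Fin n) (c0 : Fin n ≃ Fin n)
    (hinit : ∀ w : Fin n, sDepth (c0 w) = Nat.log 2 (itemRank r0 σ 0 w))
    (t : ℕ) (v : Fin n) (i : ℕ) (hri : itemRank r0 σ t v = i)
    (t0 : ℕ) (ht0 : t0 < t) (hreq : σ t0 = v)
    (hlast : ∀ s, t0 < s → s < t → σ s ≠ v) :
    (∑ ω : Fin t → Fin K → Bool,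
          ((((Finset.Ioo t0 t).filter (fun s =>
              sDepth (rpConf hpos c0 σ (extendFlips t K ω) s v) <
              sDepth (rpConf hpos c0 σ (extendFlips t K ω) s (σ s)))).card : ℝ)))
        / (Fintype.card (Fin t → Fin K → Bool) : ℝ)
      ≤ 2 * (i : ℝ) - 1 := by
  obtain ⟨-, hcard⟩ := itemRank_eq_card_add_one r0 σ hreq ht0 hlast
  have h1 := expect_two_pow_le_of_expect_pushPotential_le v _ _
    (expect_pushPotential_rpConf_le hn hpos σ c0 hreq hlast ht0 le_rfl)
  have h2 := expect_card_deeper_requests hn hpos σ c0 hreq hlast ht0 le_rfl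
  rw [← Fintype.expect_eq_sum_div_card, h2, ← hri, hcard]
  push_cast
  linarith
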